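/- arXiv:1112.1201 — 2 statements merged into one kernel-verified Lean document; each statement's English description precedes it below -/
import Mathlib

section
/- The map G_{f₀} is topologically transitive on (X,d): for all nonempty open sets U, V ⊆ X there exists k > 0 such that G_{f₀}^k(U) ∩ V ≠ ∅. -/
open scoped BigOperators

/-- Sum of the discrete Boolean metric over the `N` coordinates (Hamming-type distance). -/
noncomputable def de (N : ℕ) (E F : Fin N → Bool) : ℝ :=
  ∑ k : Fin N, if E k = F k then (0 : ℝ) else 1

/-- Distance between strategies: `(9/N) Σ_k |S^k − Š^k| / 10^k`. -/
noncomputable def ds (N : ℕ) (S T : ℕ → Fin N) : ℝ :=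
  (9 / N) * ∑' k : ℕ, |((S k : ℕ) : ℝ) - ((T k : ℕ) : ℝ)| / 10 ^ (k + 1)

/-- The distance on the phase space `X = {1,…,N}^ℕ × B^N`. -/
noncomputable def dX (N : ℕ) (x y : (ℕ → Fin N) × (Fin N → Bool)) : ℝ :=
  de N x.2 y.2 + ds N x.1 y.1

/-- `F_f(k,E)` agrees with `E` except in coordinate `k`, where it equals `f(E)_k`. -/
def Ff (N : ℕ) (f : (Fin N → Bool) → (Fin N → Bool)) (k : Fin N) (E : Fin N → Bool) :
    Fin N → Bool :=
  fun j => if j = k then f E k else E j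

/-- `G_f(S,E) = (σ(S), F_f(S^1,E))`, where `σ` is the shift on strategies. -/
def G (N : ℕ) (f : (Fin N → Bool) → (Fin N → Bool))
    (x : (ℕ → Fin N) × (Fin N → Bool)) : (ℕ → Fin N) × (Fin N → Bool) :=
  (fun n => x.1 (n + 1), Ff N f (x.1 0) x.2)

/-- The vectorial negation `f₀`. -/
def f0 (N : ℕ) (E : Fin N → Bool) : Fin N → Bool := fun i => !(E i)

/-- A set is open for the metric `dX`. -/
def dOpen (N : ℕ) (U : Set ((ℕ → Fin N) × (Fin N → Bool))) : Prop :=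
  ∀ x ∈ U, ∃ ε > 0, ∀ y, dX N x y < ε → y ∈ U

/-- A set is closed for the metric `dX`. -/
def dClosed (N : ℕ) (A : Set ((ℕ → Fin N) × (Fin N → Bool))) : Prop :=
  dOpen N Aᶜ


/-- Prepend a coordinate to a strategy. -/
def consStrategy {N : ℕ} (a : Fin N) (S : ℕ → Fin N) : ℕ → Fin N
  | 0 => a
  | n + 1 => S n

theorem G_consStrategy {N : ℕ} (f : (Fin N → Bool) → (Fin N → Bool)) (a : Fin N)
    (S : ℕ → Fin N) (E : Fin N → Bool) :
    G N f (consStrategy a S, E) = (S, Ff N f a E) := rfl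

theorem de_self (N : ℕ) (E : Fin N → Bool) : de N E E = 0 := by simp [de]

theorem ds_le_of_agree {N : ℕ} (hN : 0 < N) (n : ℕ) {S T : ℕ → Fin N}
    (h : ∀ i < n, S i = T i) : ds N S T ≤ (1 / 10) ^ n := by
  have hN' : (0 : ℝ) < N := by exact_mod_cast hN
  have hgeom : HasSum (fun k : ℕ => (N : ℝ) / 10 * (1 / 10) ^ k) (N / 9) := by
    have hsum := (hasSum_geometric_of_lt_one (r := (1 / 10 : ℝ)) (by norm_num)
      (by norm_num)).mul_left ((N : ℝ) / 10)
    rwa [show (N : ℝ) / 10 * (1 - 1 / 10)⁻¹ = N / 9 by ring] at hsum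
  have hle : ∀ k, |((S k : ℕ) : ℝ) - ((T k : ℕ) : ℝ)| / 10 ^ (k + 1) ≤
      (N : ℝ) / 10 * (1 / 10) ^ k := by
    intro k
    have hS : ((S k : ℕ) : ℝ) ≤ N := by exact_mod_cast (S k).2.le
    have hT : ((T k : ℕ) : ℝ) ≤ N := by exact_mod_cast (T k).2.le
    have habs : |((S k : ℕ) : ℝ) - ((T k : ℕ) : ℝ)| ≤ N :=
      abs_sub_le_of_nonneg_of_le (Nat.cast_nonneg _) hS (Nat.cast_nonneg _) hT
    calc _ ≤ (N : ℝ) / 10 ^ (k + 1) := by gcongr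
      _ = _ := by rw [div_pow, one_pow, pow_succ]; field_simp
  have hsum : Summable fun k => |((S k : ℕ) : ℝ) - ((T k : ℕ) : ℝ)| / 10 ^ (k + 1) :=
    Summable.of_nonneg_of_le (fun k => by positivity) hle hgeom.summable
  have htail : ∑' k, |((S k : ℕ) : ℝ) - ((T k : ℕ) : ℝ)| / 10 ^ (k + 1) ≤
      (1 / 10) ^ n * (N / 9) := by
    rw [← hsum.sum_add_tsum_nat_add n, Finset.sum_eq_zero, zero_add]
    · have hgeom' := hgeom.mul_left ((1 / 10 : ℝ) ^ n)
      rw [← hgeom'.tsum_eq]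
      refine Summable.tsum_le_tsum (fun k => (hle (k + n)).trans_eq ?_)
        ((summable_nat_add_iff n).2 hsum) hgeom'.summable
      ring
    · intro k hk
      simp [h k (Finset.mem_range.1 hk)]
  calc ds N S T ≤ 9 / N * ((1 / 10) ^ n * (N / 9)) := by
        unfold ds; gcongr
    _ = (1 / 10) ^ n := by field_simp

theorem exists_strategy_reaching {N : ℕ} (T : ℕ → Fin N) (E F : Fin N → Bool) :
    ∃ m S, (G N (f0 N))^[m] (S, E) = (T, F) := by
  suffices H : ∀ (s : Finset (Fin N)) (E : Fin N → Bool), (∀ j ∉ s, E j = F j) →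
      ∃ m S, (G N (f0 N))^[m] (S, E) = (T, F) from
    H Finset.univ E fun j hj => absurd (Finset.mem_univ j) hj
  intro s
  induction s using Finset.induction_on with
  | empty =>
    intro E h
    exact ⟨0, T, Prod.ext rfl (funext fun j => h j (Finset.notMem_empty j))⟩
  | insert a s _ ih =>
    intro E h
    by_cases ha : E a = F a
    · refine ih E fun j hj => ?_
      by_cases hja : j = a
      · rw [hja, ha]
      · exact h j (by simp [hja, hj])
    · obtain ⟨m, S, hS⟩ := ih (Ff N (f0 N) a E) fun j hj => by
        by_cases hja : j = a
        · subst hja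
          cases hE : E j <;> cases hF : F j <;> simp_all [Ff, f0]
        · simpa [Ff, hja] using h j (by simp [hja, hj])
      exact ⟨m + 1, consStrategy a S, by
        rw [Function.iterate_succ_apply, G_consStrategy, hS]⟩

theorem exists_strategy_agreeing_and_reaching {N : ℕ} (T : ℕ → Fin N) (F : Fin N → Bool)
    (n : ℕ) (S : ℕ → Fin N) (E : Fin N → Bool) :
    ∃ m S', (∀ i < n, S i = S' i) ∧ (G N (f0 N))^[m + n] (S', E) = (T, F) := by
  induction n generalizing S E with
  | zero =>
    obtain ⟨m, S', h⟩ := exists_strategy_reaching T E F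
    exact ⟨m, S', by simp, h⟩
  | succ n ih =>
    obtain ⟨m, S', hS', h⟩ := ih (fun i => S (i + 1)) (Ff N (f0 N) (S 0) E)
    refine ⟨m, consStrategy (S 0) S', ?_, ?_⟩
    · rintro (_ | i) hi
      · rfl
      · exact hS' i (by omega)
    · rw [← add_assoc, Function.iterate_succ_apply, G_consStrategy, h]

/-- `G_{f₀}` is topologically transitive on `(X,d)`. -/
theorem Gf0_transitive (N : ℕ) (hN : 2 ≤ N) :
    ∀ U V : Set ((ℕ → Fin N) × (Fin N → Bool)),
      dOpen N U → dOpen N V → U.Nonempty → V.Nonempty →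
      ∃ k : ℕ, 0 < k ∧ ∃ x ∈ U, (G N (f0 N))^[k] x ∈ V := by
  rintro U V hU - ⟨⟨S, E⟩, hx⟩ ⟨⟨T, F⟩, hy⟩
  obtain ⟨ε, hε, hball⟩ := hU _ hx
  obtain ⟨n, hn⟩ := exists_pow_lt_of_lt_one hε (by norm_num : (1 / 10 : ℝ) < 1)
  obtain ⟨m, S', hagree, hreach⟩ :=
    exists_strategy_agreeing_and_reaching T F (n + 1) S E
  refine ⟨m + (n + 1), by omega, (S', E), hball _ ?_, hreach ▸ hy⟩
  have hds : ds N S S' ≤ (1 / 10) ^ n :=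
    ds_le_of_agree (by omega) n fun i hi => hagree i (by omega)
  simp only [dX, de_self, zero_add]
  exact hds.trans_lt hn
end

section
/- G_{f₀} is chaotic on (X,d) in the sense of Devaney: it is topologically transitive, its periodic points are dense in X, and it has sensitive dependence on initial conditions. -/
open scoped BigOperators

/-- The strategy that plays the finite word `w` and then follows `S`. -/
def wordAppend {N : ℕ} (w : List (Fin N)) (S : ℕ → Fin N) : ℕ → Fin N :=
  fun n => if h : n < w.length then w[n] else S (n - w.length)

/-- The state reached from `E` by successively negating the coordinates listed in `w`. -/
def wordAct {N : ℕ} (w : List (Fin N)) (E : Fin N → Bool) : Fin N → Bool :=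
  w.foldl (fun E k => Ff N (f0 N) k E) E

theorem G_iterate_wordAppend {N : ℕ} (w : List (Fin N)) (S : ℕ → Fin N) (E : Fin N → Bool) :
    (G N (f0 N))^[w.length] (wordAppend w S, E) = (S, wordAct w E) := by
  induction w generalizing E with
  | nil => ext <;> simp [wordAppend, wordAct]
  | cons a w ih =>
    have h : G N (f0 N) (wordAppend (a :: w) S, E) = (wordAppend w S, Ff N (f0 N) a E) := by
      ext n <;> simp [G, wordAppend]
    rw [List.length_cons, Function.iterate_succ_apply, h, ih]
    rfl

theorem wordAct_append {N : ℕ} (v w : List (Fin N)) (E : Fin N → Bool) :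
    wordAct (v ++ w) E = wordAct w (wordAct v E) := by
  simp [wordAct]

theorem exists_wordAct_eq {N : ℕ} (E F : Fin N → Bool) : ∃ w, wordAct w E = F := by
  suffices h : ∀ s : Finset (Fin N), ∀ E : Fin N → Bool, (∀ i ∉ s, E i = F i) →
      ∃ w, wordAct w E = F from h Finset.univ E (by simp)
  intro s
  induction s using Finset.induction_on with
  | empty => exact fun E h => ⟨[], funext fun i => h i (by simp)⟩
  | insert a s _ ih =>
    intro E h
    by_cases ha : E a = F a
    · refine ih E fun i hi => ?_
      by_cases hia : i = a
      · rw [hia, ha]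
      · exact h i (by simp [hia, hi])
    · obtain ⟨w, hw⟩ := ih (Ff N (f0 N) a E) fun i hi => by
        by_cases hia : i = a
        · subst hia
          simpa [Ff, f0] using Bool.eq_not_of_ne ha
        · simpa [Ff, hia] using h i (by simp [hia, hi])
      exact ⟨a :: w, hw⟩

theorem wordAppend_map_range {N : ℕ} (S T : ℕ → Fin N) (v : List (Fin N)) {m k : ℕ}
    (hk : k < m) : wordAppend ((List.range m).map S ++ v) T k = S k := by
  have h : k < ((List.range m).map S ++ v).length := by simp; omega
  simp only [wordAppend, h, dif_pos]
  rw [List.getElem_append_left (by simpa using hk)]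
  simp

theorem wordAppend_map_range_self {N : ℕ} (S : ℕ → Fin N) (m : ℕ) :
    wordAppend ((List.range m).map S) (fun k => S (k + m)) = S := by
  ext k
  by_cases hk : k < m
  · simp [wordAppend, hk]
  · simp [wordAppend, hk, Nat.sub_add_cancel (not_lt.mp hk)]

theorem exists_wordAppend_eq_self {N : ℕ} (w : List (Fin N)) (hw : 0 < w.length) :
    ∃ T, wordAppend w T = T := by
  refine ⟨fun k => w[k % w.length]'(Nat.mod_lt _ hw), funext fun k => ?_⟩
  by_cases hk : k < w.length
  · simp [wordAppend, hk, Nat.mod_eq_of_lt hk]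
  · simp [wordAppend, hk, ← Nat.mod_eq_sub_mod (not_lt.mp hk)]

theorem ds_nonneg (N : ℕ) (S T : ℕ → Fin N) : 0 ≤ ds N S T :=
  mul_nonneg (by positivity) (tsum_nonneg fun _ => by positivity)

theorem ds_le_of_eqOn_prefix {N m : ℕ} {S T : ℕ → Fin N} (h : ∀ k < m, S k = T k) :
    ds N S T ≤ (1 / 10) ^ m := by
  have hN : (0 : ℝ) < N := by exact_mod_cast (S 0).pos
  have hle : ∀ k, |((S k : ℕ) : ℝ) - ((T k : ℕ) : ℝ)| / 10 ^ (k + 1) ≤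
      N / 10 * (1 / 10) ^ k := by
    intro k
    have h1 : ((S k : ℕ) : ℝ) < N := by exact_mod_cast (S k).isLt
    have h2 : ((T k : ℕ) : ℝ) < N := by exact_mod_cast (T k).isLt
    have h3 : |((S k : ℕ) : ℝ) - ((T k : ℕ) : ℝ)| ≤ N := by
      rw [abs_le]
      constructor <;> linarith [(S k : ℕ).cast_nonneg (α := ℝ), (T k : ℕ).cast_nonneg (α := ℝ)]
    calc _ ≤ (N : ℝ) / 10 ^ (k + 1) := by gcongr
      _ = _ := by rw [one_div, inv_pow, pow_succ]; field_simp
  have hgeom : HasSum (fun k : ℕ => (N : ℝ) / 10 * (1 / 10) ^ k) (N / 10 * (1 - 1 / 10)⁻¹) :=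
    (hasSum_geometric_of_lt_one (by norm_num) (by norm_num)).mul_left _
  have hs : Summable fun k => |((S k : ℕ) : ℝ) - ((T k : ℕ) : ℝ)| / 10 ^ (k + 1) :=
    Summable.of_nonneg_of_le (fun _ => by positivity) hle hgeom.summable
  have htail : ∑' k, |((S (k + m) : ℕ) : ℝ) - ((T (k + m) : ℕ) : ℝ)| / 10 ^ (k + m + 1) ≤
      N / 10 * (1 - 1 / 10)⁻¹ * (1 / 10) ^ m := by
    exact hasSum_le (fun k => (hle (k + m)).trans_eq (by rw [pow_add]; ring))
      ((summable_nat_add_iff m).2 hs).hasSum (hgeom.mul_right _)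
  have hhead : ∑ k ∈ Finset.range m, |((S k : ℕ) : ℝ) - ((T k : ℕ) : ℝ)| / 10 ^ (k + 1) = 0 :=
    Finset.sum_eq_zero fun k hk => by simp [h k (Finset.mem_range.1 hk)]
  rw [ds, ← hs.sum_add_tsum_nat_add m, hhead, zero_add]
  calc _ ≤ 9 / (N : ℝ) * (N / 10 * (1 - 1 / 10)⁻¹ * (1 / 10) ^ m) := by gcongr
    _ = _ := by field_simp; norm_num

theorem exists_dX_lt {N : ℕ} (S : ℕ → Fin N) (E : Fin N → Bool) {ε : ℝ} (hε : 0 < ε) :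
    ∃ m, 0 < m ∧ ∀ T : ℕ → Fin N, (∀ k < m, S k = T k) → dX N (S, E) (T, E) < ε := by
  obtain ⟨m, hm⟩ := exists_pow_lt_of_lt_one hε (by norm_num : (1 / 10 : ℝ) < 1)
  refine ⟨m + 1, m.succ_pos, fun T hT => ?_⟩
  have h := ds_le_of_eqOn_prefix (m := m) fun k hk => hT k (hk.trans m.lt_succ_self)
  simpa [dX, de] using h.trans_lt hm

theorem one_le_dX_of_ne {N : ℕ} {x y : (ℕ → Fin N) × (Fin N → Bool)} (i : Fin N)
    (h : x.2 i ≠ y.2 i) : 1 ≤ dX N x y := by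
  have h1 : (1 : ℝ) ≤ de N x.2 y.2 := by
    have := Finset.single_le_sum (f := fun k => if x.2 k = y.2 k then (0 : ℝ) else 1)
      (fun k _ => by split_ifs <;> norm_num) (Finset.mem_univ i)
    simpa [h, de] using this
  have := ds_nonneg N x.1 y.1
  rw [dX]
  linarith

/-- `G_{f₀}` is chaotic in the sense of Devaney: topologically transitive, with dense
periodic points, and sensitive to initial conditions. -/
theorem Gf0_devaney_chaotic (N : ℕ) (hN : 2 ≤ N) :
    (∀ U V : Set ((ℕ → Fin N) × (Fin N → Bool)),
      dOpen N U → dOpen N V → U.Nonempty → V.Nonempty →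
      ∃ k : ℕ, 0 < k ∧ ∃ x ∈ U, (G N (f0 N))^[k] x ∈ V) ∧
    (∀ x : (ℕ → Fin N) × (Fin N → Bool), ∀ ε > (0 : ℝ),
      ∃ p : (ℕ → Fin N) × (Fin N → Bool), ∃ n : ℕ, 0 < n ∧
        (G N (f0 N))^[n] p = p ∧ dX N x p < ε) ∧
    (∃ ε > (0 : ℝ), ∀ x : (ℕ → Fin N) × (Fin N → Bool), ∀ δ > (0 : ℝ),
      ∃ y : (ℕ → Fin N) × (Fin N → Bool), ∃ n : ℕ,
        dX N x y < δ ∧ ε ≤ dX N ((G N (f0 N))^[n] x) ((G N (f0 N))^[n] y)) := by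
  refine ⟨?_, ?_, 1, one_pos, ?_⟩
  · rintro U V hU - ⟨⟨S, E⟩, hx⟩ ⟨⟨T, F⟩, hy⟩
    obtain ⟨ε, hε, hball⟩ := hU _ hx
    obtain ⟨m, hm, hclose⟩ := exists_dX_lt S E hε
    obtain ⟨v, hv⟩ := exists_wordAct_eq (wordAct ((List.range m).map S) E) F
    refine ⟨((List.range m).map S ++ v).length, by simp; omega,
      (wordAppend ((List.range m).map S ++ v) T, E),
      hball _ (hclose _ fun k hk => (wordAppend_map_range S T v hk).symm), ?_⟩
    rwa [G_iterate_wordAppend, wordAct_append, hv]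
  · rintro ⟨S, E⟩ ε hε
    obtain ⟨m, hm, hclose⟩ := exists_dX_lt S E hε
    obtain ⟨v, hv⟩ := exists_wordAct_eq (wordAct ((List.range m).map S) E) E
    have hpos : 0 < ((List.range m).map S ++ v).length := by simp; omega
    obtain ⟨T, hT⟩ := exists_wordAppend_eq_self _ hpos
    refine ⟨(T, E), _, hpos, ?_, hclose T fun k hk => ?_⟩
    · have h := G_iterate_wordAppend ((List.range m).map S ++ v) T E
      rwa [hT, wordAct_append, hv] at h
    · rw [← hT, wordAppend_map_range S T v hk]
  · rintro ⟨S, E⟩ δ hδ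
    obtain ⟨m, -, hclose⟩ := exists_dX_lt S E hδ
    have : Nontrivial (Fin N) := Fin.nontrivial_iff_two_le.2 hN
    obtain ⟨c, hc⟩ := exists_ne (S m)
    set w := (List.range m).map S with hw
    have hx := G_iterate_wordAppend w (fun k => S (k + m)) E
    rw [hw, wordAppend_map_range_self, ← hw] at hx
    refine ⟨(wordAppend w fun _ => c, E), w.length + 1, hclose _ fun k hk => ?_, ?_⟩
    · simpa using (wordAppend_map_range S (fun _ => c) [] hk).symm
    · rw [Function.iterate_succ_apply', Function.iterate_succ_apply', hx, G_iterate_wordAppend]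
      exact one_le_dX_of_ne c (by simp [G, Ff, f0, hc])
end
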